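/- arXiv:2108.03535 — 3 statements merged into one kernel-verified Lean document; each statement's English description precedes it below -/
import Mathlib

section
/- Let f : X → Y be a quasihomogeneous homeomorphism between metric spaces. If X has the Lipschitz Clustering Property, then Y has the Lipschitz Clustering Property. -/
/-- `A` is a member of the finite subset space `Y(n)` of the subset `Y` of a metric
space: `A` is a nonempty subset of `Y` with at most `n` elements. -/
def MemFinSubsetSpace {X : Type*} (Y : Set X) (n : ℕ) (A : Set X) : Prop :=
  A.Finite ∧ A.Nonempty ∧ A.ncard ≤ n ∧ A ⊆ Y

/-- `r` is a retraction from `Y(n)` onto `Y(m)` which is `L`-Lipschitz with respect to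
the Hausdorff metric. -/
def IsLipschitzRetraction {X : Type*} [MetricSpace X] (Y : Set X) (n m : ℕ) (L : ℝ)
    (r : Set X → Set X) : Prop :=
  (∀ A, MemFinSubsetSpace Y n A → MemFinSubsetSpace Y m (r A)) ∧
  (∀ A, MemFinSubsetSpace Y m A → r A = A) ∧
  (∀ A B, MemFinSubsetSpace Y n A → MemFinSubsetSpace Y n B →
    Metric.hausdorffDist (r A) (r B) ≤ L * Metric.hausdorffDist A B)

/-- The subset `Y ⊆ X` has the Lipschitz Clustering Property: for every `n ≥ 2` there
is a Lipschitz retraction from `Y(n)` onto `Y(n-1)`. -/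
def HasLCP {X : Type*} [MetricSpace X] (Y : Set X) : Prop :=
  ∀ n : ℕ, 2 ≤ n → ∃ (L : ℝ) (r : Set X → Set X), IsLipschitzRetraction Y n (n - 1) L r

open Metric in
/-- A point of `A` is within the Hausdorff distance of some point of the finite set `B`. -/
theorem exists_dist_le_hausdorffDist_of_finite {X : Type*} [MetricSpace X] {A B : Set X}
    (hA : A.Finite) (hB : B.Finite) (hB' : B.Nonempty) {a : X} (ha : a ∈ A) :
    ∃ b ∈ B, dist a b ≤ hausdorffDist A B := by
  obtain ⟨b, hb, hab⟩ := hB.isCompact.exists_infDist_eq_dist hB' a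
  exact ⟨b, hb, hab ▸ infDist_le_hausdorffDist_of_mem ha
    (hausdorffEDist_ne_top_of_nonempty_of_bounded ⟨a, ha⟩ hB' hA.isBounded hB.isBounded)⟩

open Metric in
/-- The Hausdorff distance of finite nonempty sets is attained as the distance from a point
of one of them to the other one. -/
theorem exists_hausdorffDist_le_infDist_of_finite {X : Type*} [MetricSpace X] {A B : Set X}
    (hA : A.Finite) (hA' : A.Nonempty) (hB : B.Finite) (hB' : B.Nonempty) :
    (∃ a ∈ A, hausdorffDist A B ≤ infDist a B) ∨
      ∃ b ∈ B, hausdorffDist A B ≤ infDist b A := by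
  obtain ⟨a, ha, hamax⟩ := A.exists_max_image (infDist · B) hA hA'
  obtain ⟨b, hb, hbmax⟩ := B.exists_max_image (infDist · A) hB hB'
  rcases le_total (infDist a B) (infDist b A) with h | h
  · exact .inr ⟨b, hb, hausdorffDist_le_of_infDist infDist_nonneg
      (fun x hx => (hamax x hx).trans h) hbmax⟩
  · exact .inl ⟨a, ha, hausdorffDist_le_of_infDist infDist_nonneg hamax
      (fun x hx => (hbmax x hx).trans h)⟩

open Metric in
/-- For finite nonempty sets `A` and `B`, some pair of points is at least as far apart as the
Hausdorff distance of `A` and `B`, while its image under `f` is at most as far apart as the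
Hausdorff distance of the images. -/
theorem exists_hausdorffDist_le_dist_and_dist_le {X Y : Type*} [MetricSpace X] [MetricSpace Y]
    (f : X → Y) {A B : Set X}
    (hA : A.Finite) (hA' : A.Nonempty) (hB : B.Finite) (hB' : B.Nonempty) :
    ∃ a b, hausdorffDist A B ≤ dist a b ∧
      dist (f a) (f b) ≤ hausdorffDist (f '' A) (f '' B) := by
  rcases exists_hausdorffDist_le_infDist_of_finite hA hA' hB hB' with ⟨a, ha, h⟩ | ⟨a, ha, h⟩
  · obtain ⟨_, ⟨b, hb, rfl⟩, hab⟩ := exists_dist_le_hausdorffDist_of_finite (hA.image f)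
      (hB.image f) (hB'.image f) (Set.mem_image_of_mem f ha)
    exact ⟨a, b, h.trans (infDist_le_dist_of_mem hb), hab⟩
  · obtain ⟨_, ⟨b, hb, rfl⟩, hab⟩ := exists_dist_le_hausdorffDist_of_finite (hB.image f)
      (hA.image f) (hA'.image f) (Set.mem_image_of_mem f ha)
    exact ⟨a, b, h.trans (infDist_le_dist_of_mem hb), by rwa [hausdorffDist_comm]⟩

open Metric in
/-- A quasihomogeneous map preserves linear bounds between Hausdorff distances of finite sets. -/
theorem hausdorffDist_image_le_of_quasihomogeneous {X Y : Type*} [MetricSpace X] [MetricSpace Y]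
    {f : X → Y} {η : ℝ → ℝ} (hη_mono : MonotoneOn η (Set.Ici 0))
    (hη_nonneg : Set.MapsTo η (Set.Ici 0) (Set.Ici 0))
    (hqh : ∀ x₁ x₂ x₃ x₄ : X, x₃ ≠ x₄ →
      dist (f x₁) (f x₂) ≤ η (dist x₁ x₂ / dist x₃ x₄) * dist (f x₃) (f x₄))
    {A B A' B' : Set X} (hA : A.Finite) (hA₀ : A.Nonempty) (hB : B.Finite) (hB₀ : B.Nonempty)
    (hA' : A'.Finite) (hA'₀ : A'.Nonempty) (hB' : B'.Finite) (hB'₀ : B'.Nonempty)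
    {L : ℝ} (hL : 0 ≤ L) (h : hausdorffDist A' B' ≤ L * hausdorffDist A B) :
    hausdorffDist (f '' A') (f '' B') ≤ η L * hausdorffDist (f '' A) (f '' B) := by
  have hηL : 0 ≤ η L := hη_nonneg hL
  have key : ∀ x y, dist x y ≤ hausdorffDist A' B' →
      dist (f x) (f y) ≤ η L * hausdorffDist (f '' A) (f '' B) := by
    intro x y hxy
    obtain ⟨a, b, hab, hfab⟩ := exists_hausdorffDist_le_dist_and_dist_le f hA hA₀ hB hB₀
    have hle : dist x y ≤ L * dist a b := (hxy.trans h).trans (by gcongr)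
    rcases eq_or_ne a b with rfl | hne
    · have : x = y := dist_le_zero.1 (by simpa using hle)
      subst this
      simpa using mul_nonneg hηL hausdorffDist_nonneg
    · have hpos := dist_pos.2 hne
      calc dist (f x) (f y) ≤ η (dist x y / dist a b) * dist (f a) (f b) := hqh x y a b hne
        _ ≤ η L * hausdorffDist (f '' A) (f '' B) := by
          gcongr
          exact hη_mono (Set.mem_Ici.2 (by positivity)) hL ((div_le_iff₀ hpos).2 hle)
  refine hausdorffDist_le_of_mem_dist (mul_nonneg hηL hausdorffDist_nonneg) ?_ ?_
  · rintro _ ⟨x, hx, rfl⟩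
    obtain ⟨y, hy, hxy⟩ := exists_dist_le_hausdorffDist_of_finite hA' hB' hB'₀ hx
    exact ⟨f y, Set.mem_image_of_mem f hy, key x y hxy⟩
  · rintro _ ⟨x, hx, rfl⟩
    obtain ⟨y, hy, hxy⟩ := exists_dist_le_hausdorffDist_of_finite hB' hA' hA'₀ hx
    exact ⟨f y, Set.mem_image_of_mem f hy, key x y (by rwa [hausdorffDist_comm])⟩

/-- The image of a member of `X(n)` is a member of `Y(n)`. -/
theorem MemFinSubsetSpace.image {X Y : Type*} {n : ℕ} {A : Set X}
    (hA : MemFinSubsetSpace Set.univ n A) (f : X → Y) :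
    MemFinSubsetSpace Set.univ n (f '' A) :=
  ⟨hA.1.image f, hA.2.1.image f, (Set.ncard_image_le hA.1).trans hA.2.2.1, Set.subset_univ _⟩

/-- Proposition 6.7: if `f : X → Y` is a quasihomogeneous homeomorphism (with distortion
a self-homeomorphism `η` of `[0, ∞)`) and `X` has the Lipschitz Clustering Property,
then so does `Y`. The quasihomogeneity condition
`d(f x₁, f x₂)/d(f x₃, f x₄) ≤ η (d(x₁,x₂)/d(x₃,x₄))` is stated multiplicatively. -/
theorem quasihomogeneous_preserves_LCP {X Y : Type*} [MetricSpace X] [MetricSpace Y]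
    (f : X ≃ₜ Y) (η : ℝ → ℝ)
    (hη_mono : StrictMonoOn η (Set.Ici (0 : ℝ)))
    (hη_cont : ContinuousOn η (Set.Ici (0 : ℝ)))
    (hη_bij : Set.BijOn η (Set.Ici (0 : ℝ)) (Set.Ici (0 : ℝ)))
    (hqh : ∀ x₁ x₂ x₃ x₄ : X, x₃ ≠ x₄ →
      dist (f x₁) (f x₂) ≤ η (dist x₁ x₂ / dist x₃ x₄) * dist (f x₃) (f x₄))
    (hX : HasLCP (Set.univ : Set X)) :
    HasLCP (Set.univ : Set Y) := by
  intro n hn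
  obtain ⟨L, r, hmem, hfix, hlip⟩ := hX n hn
  have himage : ∀ A : Set Y, f '' (f.symm '' A) = A := fun A => by simp [Set.image_image]
  refine ⟨η (max L 0), fun A => f '' r (f.symm '' A), fun A hA => ?_, fun A hA => ?_,
    fun A B hA hB => ?_⟩
  · exact (hmem _ (hA.image f.symm)).image f
  · simp only [hfix _ (hA.image f.symm), himage]
  · have hA' := hA.image f.symm
    have hB' := hB.image f.symm
    have hrA := hmem _ hA'
    have hrB := hmem _ hB'
    have h := hausdorffDist_image_le_of_quasihomogeneous hη_mono.monotoneOn hη_bij.mapsTo hqh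
      hA'.1 hA'.2.1 hB'.1 hB'.2.1 hrA.1 hrA.2.1 hrB.1 hrB.2.1 (le_max_right L 0)
      ((hlip _ _ hA' hB').trans
        (mul_le_mul_of_nonneg_right (le_max_left L 0) Metric.hausdorffDist_nonneg))
    rwa [himage, himage] at h
end

section
/- Let f : X → Y be a quasihomogeneous homeomorphism between metric spaces with distortion function η, and let n ≥ 1. If A₁, A₂, A₃, A₄ are nonempty subsets of X with at most n elements, A₃ ≠ A₄, and Δ_X(A₁, A₂) ≤ t·Δ_X(A₃, A₄) for some t > 0, then Δ_Y(f(A₁), f(A₂)) ≤ η(t)·Δ_Y(f(A₃), f(A₄)), where Δ_X, Δ_Y denote Hausdorff distances and f(A) denotes the image set. In other words, the induced map A ↦ f(A) from X(n) to Y(n) is η-quasihomogeneous. -/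
/-- A point of a set has a partner in a finite nonempty set at most one Hausdorff distance away. -/
theorem Set.Finite.exists_dist_le_hausdorffDist {X : Type*} [MetricSpace X] {A B : Set X}
    (hA : A.Finite) (hB : B.Finite) (hBne : B.Nonempty) {a : X} (ha : a ∈ A) :
    ∃ b ∈ B, dist a b ≤ Metric.hausdorffDist A B := by
  obtain ⟨b, hb, hab⟩ := hB.isCompact.exists_infDist_eq_dist hBne a
  refine ⟨b, hb, hab ▸ Metric.infDist_le_hausdorffDist_of_mem ha ?_⟩
  exact Metric.hausdorffEDist_ne_top_of_nonempty_of_bounded ⟨a, ha⟩ hBne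
    hA.isBounded hB.isBounded

/-- Among the pairs of points whose images are at most the Hausdorff distance of the image sets
apart, some pair is at least the Hausdorff distance of the original sets apart. -/
theorem exists_hausdorffDist_le_dist_and_dist_image_le {X Y : Type*} [MetricSpace X]
    [MetricSpace Y] (f : X → Y) {A B : Set X} (hA : A.Finite) (hAne : A.Nonempty)
    (hB : B.Finite) (hBne : B.Nonempty) :
    ∃ a b : X, Metric.hausdorffDist A B ≤ dist a b ∧
      dist (f a) (f b) ≤ Metric.hausdorffDist (f '' A) (f '' B) := by
  let P : Set (X × X) :=
    {p ∈ A ×ˢ B | dist (f p.1) (f p.2) ≤ Metric.hausdorffDist (f '' A) (f '' B)}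
  have hleft : ∀ a ∈ A, ∃ b ∈ B, (a, b) ∈ P := by
    intro a ha
    obtain ⟨_, ⟨b, hb, rfl⟩, h⟩ := (hA.image f).exists_dist_le_hausdorffDist (hB.image f)
      (hBne.image f) (Set.mem_image_of_mem f ha)
    exact ⟨b, hb, ⟨ha, hb⟩, h⟩
  have hright : ∀ b ∈ B, ∃ a ∈ A, (a, b) ∈ P := by
    intro b hb
    obtain ⟨_, ⟨a, ha, rfl⟩, h⟩ := (hB.image f).exists_dist_le_hausdorffDist (hA.image f)
      (hAne.image f) (Set.mem_image_of_mem f hb)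
    rw [dist_comm, Metric.hausdorffDist_comm] at h
    exact ⟨a, ha, ⟨ha, hb⟩, h⟩
  have hPfin : P.Finite := (hA.prod hB).subset fun _ hp => hp.1
  have hPne : P.Nonempty := by
    obtain ⟨a, ha⟩ := hAne
    obtain ⟨b, -, h⟩ := hleft a ha
    exact ⟨_, h⟩
  obtain ⟨⟨a, b⟩, hab, hmax⟩ :=
    Set.exists_max_image P (fun p => dist p.1 p.2) hPfin hPne
  refine ⟨a, b, Metric.hausdorffDist_le_of_mem_dist dist_nonneg ?_ ?_, hab.2⟩
  · intro x hx
    obtain ⟨y, hy, h⟩ := hleft x hx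
    exact ⟨y, hy, hmax _ h⟩
  · intro y hy
    obtain ⟨x, hx, h⟩ := hright y hy
    exact ⟨x, hx, dist_comm y x ▸ hmax _ h⟩

/-- Quantitative form of the observation in Proposition 6.7: if `f : X → Y` is a
quasihomogeneous homeomorphism with distortion function `η` (a self-homeomorphism of
`[0, ∞)`), then the induced map `A ↦ f(A)` between finite subset spaces is
`η`-quasihomogeneous: for nonempty sets `A₁, …, A₄` with at most `n` elements,
`A₃ ≠ A₄` and `Δ(A₁, A₂) ≤ t Δ(A₃, A₄)` imply
`Δ(f(A₁), f(A₂)) ≤ η(t) Δ(f(A₃), f(A₄))`. -/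
theorem induced_map_quasihomogeneous {X Y : Type*} [MetricSpace X] [MetricSpace Y]
    (f : X ≃ₜ Y) (η : ℝ → ℝ)
    (hη_mono : StrictMonoOn η (Set.Ici (0 : ℝ)))
    (hη_cont : ContinuousOn η (Set.Ici (0 : ℝ)))
    (hη_bij : Set.BijOn η (Set.Ici (0 : ℝ)) (Set.Ici (0 : ℝ)))
    (hqh : ∀ x₁ x₂ x₃ x₄ : X, x₃ ≠ x₄ →
      dist (f x₁) (f x₂) ≤ η (dist x₁ x₂ / dist x₃ x₄) * dist (f x₃) (f x₄))
    (n : ℕ) (t : ℝ) (ht : 0 < t) (A₁ A₂ A₃ A₄ : Set X)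
    (h₁ : A₁.Finite ∧ A₁.Nonempty ∧ A₁.ncard ≤ n)
    (h₂ : A₂.Finite ∧ A₂.Nonempty ∧ A₂.ncard ≤ n)
    (h₃ : A₃.Finite ∧ A₃.Nonempty ∧ A₃.ncard ≤ n)
    (h₄ : A₄.Finite ∧ A₄.Nonempty ∧ A₄.ncard ≤ n)
    (h34 : A₃ ≠ A₄)
    (hΔ : Metric.hausdorffDist A₁ A₂ ≤ t * Metric.hausdorffDist A₃ A₄) :
    Metric.hausdorffDist (f '' A₁) (f '' A₂) ≤
      η t * Metric.hausdorffDist (f '' A₃) (f '' A₄) := by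
  obtain ⟨c, d, hcd, hfcd⟩ := exists_hausdorffDist_le_dist_and_dist_image_le f
    h₃.1 h₃.2.1 h₄.1 h₄.2.1
  have hpos : 0 < Metric.hausdorffDist A₃ A₄ := by
    refine Metric.hausdorffDist_nonneg.lt_of_ne' fun h => h34 ?_
    exact (h₃.1.isClosed.hausdorffDist_zero_iff_eq h₄.1.isClosed
      (Metric.hausdorffEDist_ne_top_of_nonempty_of_bounded h₃.2.1 h₄.2.1
        h₃.1.isBounded h₄.1.isBounded)).1 h
  have hcd_pos : 0 < dist c d := hpos.trans_le hcd
  have hηt : 0 ≤ η t := hη_bij.mapsTo ht.le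
  have key : ∀ a b : X, dist a b ≤ Metric.hausdorffDist A₁ A₂ →
      dist (f a) (f b) ≤ η t * Metric.hausdorffDist (f '' A₃) (f '' A₄) := by
    intro a b hab
    have hratio : dist a b / dist c d ≤ t := by
      rw [div_le_iff₀ hcd_pos]
      exact (hab.trans hΔ).trans (by gcongr)
    have hη : η (dist a b / dist c d) ≤ η t :=
      hη_mono.monotoneOn (div_nonneg dist_nonneg dist_nonneg) ht.le hratio
    calc dist (f a) (f b) ≤ η (dist a b / dist c d) * dist (f c) (f d) :=
          hqh a b c d (dist_pos.1 hcd_pos)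
      _ ≤ η t * Metric.hausdorffDist (f '' A₃) (f '' A₄) := by gcongr
  refine Metric.hausdorffDist_le_of_mem_dist
    (mul_nonneg hηt Metric.hausdorffDist_nonneg) ?_ ?_
  · rintro _ ⟨a, ha, rfl⟩
    obtain ⟨b, hb, hab⟩ := h₁.1.exists_dist_le_hausdorffDist h₂.1 h₂.2.1 ha
    exact ⟨f b, Set.mem_image_of_mem f hb, key a b hab⟩
  · rintro _ ⟨b, hb, rfl⟩
    obtain ⟨a, ha, hba⟩ := h₂.1.exists_dist_le_hausdorffDist h₁.1 h₁.2.1 hb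
    rw [Metric.hausdorffDist_comm] at hba
    exact ⟨f a, Set.mem_image_of_mem f ha, key b a hba⟩
end

section
/- Let P = {(x, x²) : x ∈ ℝ} ⊂ ℝ² be the parabola with the metric inherited from the Euclidean plane. Then P does not have the Lipschitz Clustering Property; specifically, there exists no Lipschitz retraction from P(4) onto P(3). -/
/-- The parabola `P = {(x, x²) : x ∈ ℝ}` in the Euclidean plane. -/
def parabola : Set (EuclideanSpace ℝ (Fin 2)) := {p | p 1 = (p 0) ^ 2}

/-- The point of the parabola with abscissa `x`. -/
noncomputable def parabolaPoint (x : ℝ) : EuclideanSpace ℝ (Fin 2) := !₂[x, x ^ 2]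

@[simp] lemma parabolaPoint_zero (x : ℝ) : parabolaPoint x 0 = x := by simp [parabolaPoint]

@[simp] lemma parabolaPoint_one (x : ℝ) : parabolaPoint x 1 = x ^ 2 := by simp [parabolaPoint]

lemma parabolaPoint_mem (x : ℝ) : parabolaPoint x ∈ parabola := by simp [parabola]

lemma abs_sub_apply_le_dist (p q : EuclideanSpace ℝ (Fin 2)) (i : Fin 2) :
    |p i - q i| ≤ dist p q := by
  rw [dist_eq_norm]
  simpa using PiLp.norm_apply_le (p - q) i

lemma dist_parabolaPoint_le (x y : ℝ) :
    dist (parabolaPoint x) (parabolaPoint y) ≤ |x - y| + |x ^ 2 - y ^ 2| := by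
  rw [EuclideanSpace.dist_eq, Fin.sum_univ_two]
  simp only [parabolaPoint_zero, parabolaPoint_one, Real.dist_eq]
  refine Real.sqrt_le_iff.2 ⟨by positivity, ?_⟩
  nlinarith [mul_nonneg (abs_nonneg (x - y)) (abs_nonneg (x ^ 2 - y ^ 2))]

lemma dist_parabolaPoint_neg_le {x : ℝ} (hx : 0 ≤ x) :
    dist (parabolaPoint (-x)) (parabolaPoint x) ≤ 2 * x := by
  have h := dist_parabolaPoint_le (-x) x
  have h1 : |-x - x| = 2 * x := by rw [abs_of_nonpos] <;> linarith
  simpa [h1] using h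

lemma MemFinSubsetSpace.mono {X : Type*} {Y : Set X} {m n : ℕ} (hmn : m ≤ n) {A : Set X}
    (hA : MemFinSubsetSpace Y m A) : MemFinSubsetSpace Y n A :=
  ⟨hA.1, hA.2.1, hA.2.2.1.trans hmn, hA.2.2.2⟩

lemma memFinSubsetSpace_image {X ι : Type*} {Y : Set X} {f : ι → X}
    (hf : ∀ i, f i ∈ Y) (s : Finset ι) (hs : s.Nonempty) {n : ℕ} (hn : s.card ≤ n) :
    MemFinSubsetSpace Y n (f '' s) := by
  refine ⟨s.finite_toSet.image f, (Finset.coe_nonempty.2 hs).image f, ?_, ?_⟩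
  · exact (Set.ncard_image_le s.finite_toSet).trans (by simpa using hn)
  · rintro _ ⟨i, -, rfl⟩
    exact hf i

/-- A Lipschitz retraction moves every point of `r A` by less than `ε` to a point of `r B`,
provided that `A` and `B` are `d`-close and `L * d < ε`. -/
lemma IsLipschitzRetraction.exists_dist_lt {X : Type*} [MetricSpace X] {Y : Set X} {n m : ℕ}
    {L d ε : ℝ} {r : Set X → Set X} (hr : IsLipschitzRetraction Y n m L r) (hL : 0 ≤ L)
    {A B : Set X} (hA : MemFinSubsetSpace Y n A) (hB : MemFinSubsetSpace Y n B)
    (hAB : Metric.hausdorffDist A B ≤ d) (hε : L * d < ε) {p : X} (hp : p ∈ r A) :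
    ∃ q ∈ r B, dist p q < ε := by
  have hrA := hr.1 A hA
  have hrB := hr.1 B hB
  refine Metric.exists_dist_lt_of_hausdorffDist_lt hp ?_ ?_
  · exact ((hr.2.2 A B hA hB).trans (mul_le_mul_of_nonneg_left hAB hL)).trans_lt hε
  · exact Metric.hausdorffEDist_ne_top_of_nonempty_of_bounded hrA.2.1 hrB.2.1
      hrA.1.isBounded hrB.1.isBounded

lemma IsLipschitzRetraction.mono {X : Type*} [MetricSpace X] {Y : Set X} {n m : ℕ}
    {L K : ℝ} {r : Set X → Set X} (hr : IsLipschitzRetraction Y n m L r) (h : L ≤ K) :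
    IsLipschitzRetraction Y n m K r :=
  ⟨hr.1, hr.2.1, fun A B hA hB => (hr.2.2 A B hA hB).trans
    (mul_le_mul_of_nonneg_right h Metric.hausdorffDist_nonneg)⟩

/-- A property of reals which propagates over distances at most `δ` inside `[0, c]` propagates
from `0` to `c`. -/
lemma propagate_Icc {P : ℝ → Prop} {c δ : ℝ} (hc : 0 ≤ c) (hδ : 0 < δ)
    (hP : ∀ x ∈ Set.Icc 0 c, ∀ y ∈ Set.Icc 0 c, |x - y| ≤ δ → P x → P y) (h0 : P 0) : P c := by
  have key : ∀ n : ℕ, P (min c (n * δ)) := by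
    intro n
    induction n with
    | zero => simpa [hc] using h0
    | succ n ih =>
      refine hP _ ⟨by positivity, min_le_left _ _⟩ _ ⟨by positivity, min_le_left _ _⟩ ?_ ih
      refine (abs_min_sub_min_le_max _ _ _ _).trans (max_le (by simpa using hδ.le) ?_)
      push_cast
      rw [abs_sub_comm, abs_of_nonneg] <;> linarith
  obtain ⟨n, hn⟩ := exists_nat_ge (c / δ)
  have h := key n
  rwa [min_eq_left ((div_le_iff₀ hδ).1 hn)] at h

/-- The set `{-b, b, x, 0}` of abscissas, as a subset of the parabola. -/
noncomputable def quadruple (b x : ℝ) : Set (EuclideanSpace ℝ (Fin 2)) :=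
  parabolaPoint '' ({-b, b, x, 0} : Finset ℝ)

/-- The set `{b, x, 0}` of abscissas, as a subset of the parabola. -/
noncomputable def triple (b x : ℝ) : Set (EuclideanSpace ℝ (Fin 2)) :=
  parabolaPoint '' ({b, x, 0} : Finset ℝ)

lemma quadruple_mem (b x : ℝ) : MemFinSubsetSpace parabola 4 (quadruple b x) :=
  memFinSubsetSpace_image parabolaPoint_mem _ (by simp) Finset.card_le_four

lemma triple_mem (b x : ℝ) : MemFinSubsetSpace parabola 3 (triple b x) :=
  memFinSubsetSpace_image parabolaPoint_mem _ (by simp) Finset.card_le_three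

lemma quadruple_zero_mem (b : ℝ) : MemFinSubsetSpace parabola 3 (quadruple b 0) := by
  have h : quadruple b 0 = parabolaPoint '' ({-b, b, 0} : Finset ℝ) := by simp [quadruple]
  rw [h]
  exact memFinSubsetSpace_image parabolaPoint_mem _ (by simp) Finset.card_le_three

lemma hausdorffDist_quadruple_triple_le {b : ℝ} (hb : 0 ≤ b) (x : ℝ) :
    Metric.hausdorffDist (quadruple b x) (triple b x) ≤ 2 * b := by
  refine Metric.hausdorffDist_le_of_mem_dist (by positivity) ?_ ?_
  · rintro _ ⟨t, ht, rfl⟩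
    by_cases h : t = -b
    · exact ⟨parabolaPoint b, ⟨b, by simp, rfl⟩, h ▸ dist_parabolaPoint_neg_le hb⟩
    · refine ⟨parabolaPoint t, ⟨t, ?_, rfl⟩, by simpa using hb⟩
      simpa [h] using ht
  · rintro _ ⟨t, ht, rfl⟩
    refine ⟨parabolaPoint t, ⟨t, ?_, rfl⟩, by simpa using hb⟩
    simp only [Finset.coe_insert, Set.mem_insert_iff] at ht ⊢
    exact Or.inr ht

lemma hausdorffDist_quadruple_le (b x y : ℝ) :
    Metric.hausdorffDist (quadruple b x) (quadruple b y) ≤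
      dist (parabolaPoint x) (parabolaPoint y) := by
  have key : ∀ x y : ℝ, ∀ p ∈ quadruple b x, ∃ q ∈ quadruple b y,
      dist p q ≤ dist (parabolaPoint x) (parabolaPoint y) := by
    rintro x y _ ⟨t, ht, rfl⟩
    by_cases h : t = x
    · exact ⟨parabolaPoint y, ⟨y, by simp, rfl⟩, by rw [h]⟩
    · refine ⟨parabolaPoint t, ⟨t, ?_, rfl⟩, by simp⟩
      simp only [Finset.coe_insert, Finset.coe_singleton, Set.mem_insert_iff,
        Set.mem_singleton_iff] at ht ⊢
      tauto
  refine Metric.hausdorffDist_le_of_mem_dist dist_nonneg (key x y) fun p hp => ?_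
  rw [dist_comm (parabolaPoint x)]
  exact key y x p hp

section Retraction

variable {L : ℝ} {r : Set (EuclideanSpace ℝ (Fin 2)) → Set (EuclideanSpace ℝ (Fin 2))}

/-- The points of `r {-b, b, x, 0}` lie either at the height of `b` or far below it. -/
lemma IsLipschitzRetraction.abs_gap (hr : IsLipschitzRetraction parabola 4 3 L r) (hL : 1 ≤ L)
    {x : ℝ} (hx : x ∈ Set.Icc 0 (16 * L)) {p : EuclideanSpace ℝ (Fin 2)}
    (hp : p ∈ r (quadruple (32 * L) x)) : |p 0| ≤ 18 * L ∨ 30 * L ≤ |p 0| := by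
  have hT := triple_mem (32 * L) x
  obtain ⟨q, hq, hpq⟩ := hr.exists_dist_lt (by linarith) (quadruple_mem _ x)
    (hT.mono (by norm_num)) (hausdorffDist_quadruple_triple_le (by positivity) x)
    (show L * (2 * (32 * L)) < 65 * L ^ 2 by nlinarith) hp
  rw [hr.2.1 _ hT] at hq
  obtain ⟨t, ht, rfl⟩ := hq
  have hpar : p 1 = p 0 ^ 2 := (hr.1 _ (quadruple_mem _ x)).2.2.2 hp
  have h1 := abs_lt.1 ((abs_sub_apply_le_dist p _ 1).trans_lt hpq)
  rw [parabolaPoint_one, hpar, ← sq_abs (p 0)] at h1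
  have hp0 := abs_nonneg (p 0)
  simp only [Finset.coe_insert, Finset.coe_singleton, Set.mem_insert_iff,
    Set.mem_singleton_iff] at ht
  rcases ht with rfl | ht
  · right
    by_contra! h
    nlinarith
  · left
    have ht2 : t ^ 2 ≤ (16 * L) ^ 2 := by
      rcases ht with rfl | rfl
      · exact pow_le_pow_left₀ hx.1 hx.2 2
      · rw [zero_pow two_ne_zero]; positivity
    by_contra! h
    nlinarith

/-- Points of `r {-b, b, x, 0}` high up on the branch of sign `s` persist from `x = 0` to
`x = b / 2`. -/
lemma IsLipschitzRetraction.exists_mem_branch (hr : IsLipschitzRetraction parabola 4 3 L r)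
    (hL : 1 ≤ L) {s : ℝ} (hs : s = 1 ∨ s = -1) :
    ∃ p ∈ r (quadruple (32 * L) (16 * L)), 20 * L < s * p 0 := by
  refine propagate_Icc (P := fun x => ∃ p ∈ r (quadruple (32 * L) x), 20 * L < s * p 0)
    (δ := (1 + 32 * L)⁻¹) (by positivity) (by positivity) ?_ ?_
  · rintro x hx y hy hxy ⟨p, hp, hsp⟩
    have hd : dist (parabolaPoint x) (parabolaPoint y) ≤ 1 := by
      refine (dist_parabolaPoint_le x y).trans ?_
      have h1 : |x ^ 2 - y ^ 2| ≤ 32 * L * |x - y| := by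
        rw [sq_sub_sq, abs_mul]
        refine mul_le_mul_of_nonneg_right ?_ (abs_nonneg _)
        rw [abs_of_nonneg (add_nonneg hx.1 hy.1)]
        linarith [hx.2, hy.2]
      have h2 : (1 + 32 * L) * |x - y| ≤ 1 := by
        exact (mul_le_mul_of_nonneg_left hxy (by positivity)).trans_eq
          (mul_inv_cancel₀ (by positivity))
      linarith
    obtain ⟨q, hq, hpq⟩ := hr.exists_dist_lt (by linarith) (quadruple_mem _ x)
      (quadruple_mem _ y) ((hausdorffDist_quadruple_le _ x y).trans hd)
      (show L * 1 < 2 * L by linarith) hp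
    refine ⟨q, hq, ?_⟩
    have h0 := abs_lt.1 ((abs_sub_apply_le_dist p q 0).trans_lt hpq)
    rcases hr.abs_gap hL hx hp with h | h
    · rcases hs with rfl | rfl <;> linarith [(abs_le.1 h).1, (abs_le.1 h).2]
    · rcases le_abs.1 h with h | h <;> rcases hs with rfl | rfl <;> linarith
  · refine ⟨parabolaPoint (s * (32 * L)), ?_, ?_⟩
    · rw [hr.2.1 _ (quadruple_zero_mem _)]
      exact ⟨s * (32 * L), by rcases hs with rfl | rfl <;> simp, rfl⟩
    · rw [parabolaPoint_zero]
      rcases hs with rfl | rfl <;> linarith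

lemma IsLipschitzRetraction.exists_mem_near (hr : IsLipschitzRetraction parabola 4 3 L r)
    (hL : 1 ≤ L) {x t : ℝ} (ht : t = x ∨ t = 0) :
    ∃ p ∈ r (quadruple (32 * L) x), |t ^ 2 - p 0 ^ 2| < 65 * L ^ 2 := by
  have hT := triple_mem (32 * L) x
  have hd := hausdorffDist_quadruple_triple_le (show 0 ≤ 32 * L by positivity) x
  rw [Metric.hausdorffDist_comm] at hd
  have hmem : parabolaPoint t ∈ r (triple (32 * L) x) := by
    rw [hr.2.1 _ hT]
    exact ⟨t, by simp [ht], rfl⟩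
  obtain ⟨p, hp, htp⟩ := hr.exists_dist_lt (by linarith) (hT.mono (by norm_num))
    (quadruple_mem _ x) hd (show L * (2 * (32 * L)) < 65 * L ^ 2 by nlinarith) hmem
  refine ⟨p, hp, ?_⟩
  have hpar : p 1 = p 0 ^ 2 := (hr.1 _ (quadruple_mem _ x)).2.2.2 hp
  have h1 := (abs_sub_apply_le_dist _ p 1).trans_lt htp
  rwa [parabolaPoint_one, hpar] at h1

end Retraction

lemma not_isLipschitzRetraction_parabola {L : ℝ}
    {r : Set (EuclideanSpace ℝ (Fin 2)) → Set (EuclideanSpace ℝ (Fin 2))} (hL : 1 ≤ L) :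
    ¬ IsLipschitzRetraction parabola 4 3 L r := by
  intro hr
  obtain ⟨p, hp, hp0⟩ := hr.exists_mem_branch hL (Or.inl rfl)
  obtain ⟨q, hq, hq0⟩ := hr.exists_mem_branch hL (Or.inr rfl)
  obtain ⟨u, hu, hu0⟩ := hr.exists_mem_near hL (x := 16 * L) (Or.inl rfl)
  obtain ⟨v, hv, hv0⟩ := hr.exists_mem_near hL (x := 16 * L) (Or.inr rfl)
  rw [abs_lt] at hu0 hv0
  have hpq : p ≠ q := by rintro rfl; linarith
  have hpu : p ≠ u := by rintro rfl; nlinarith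
  have hpv : p ≠ v := by rintro rfl; nlinarith
  have hqu : q ≠ u := by rintro rfl; nlinarith
  have hqv : q ≠ v := by rintro rfl; nlinarith
  have huv : u ≠ v := by rintro rfl; nlinarith
  obtain ⟨hfin, -, hcard, -⟩ := hr.1 _ (quadruple_mem (32 * L) (16 * L))
  have hsub : (({p, q, u, v} : Finset (EuclideanSpace ℝ (Fin 2))) : Set _) ⊆
      r (quadruple (32 * L) (16 * L)) := by
    simp [Set.insert_subset_iff, hp, hq, hu, hv]
  have h4 := Set.ncard_le_ncard hsub hfin
  have hc : ({p, q, u, v} : Finset (EuclideanSpace ℝ (Fin 2))).card = 4 := by simp [*]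
  rw [Set.ncard_coe_finset, hc] at h4
  omega

/-- Example 5.7: the parabola `P = {(x, x²)} ⊆ ℝ²`, with the Euclidean metric of the
plane, does not have the Lipschitz Clustering Property; in fact there is no Lipschitz
retraction from `P(4)` onto `P(3)`. -/
theorem parabola_no_LCP :
    (¬ ∃ (L : ℝ) (r : Set (EuclideanSpace ℝ (Fin 2)) → Set (EuclideanSpace ℝ (Fin 2))),
      IsLipschitzRetraction parabola 4 3 L r) ∧
    ¬ HasLCP parabola := by
  have h : ¬ ∃ (L : ℝ) (r : Set (EuclideanSpace ℝ (Fin 2)) → Set (EuclideanSpace ℝ (Fin 2))),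
      IsLipschitzRetraction parabola 4 3 L r := by
    rintro ⟨L, r, hr⟩
    exact not_isLipschitzRetraction_parabola (le_max_right L 1) (hr.mono (le_max_left L 1))
  exact ⟨h, fun hP => h (hP 4 (by norm_num))⟩
end
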